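/- Let (φ_i, ξ_i, η_i), i = 1,2,3, be an abelian almost 3-contact structure on a finite-dimensional real Lie algebra 𝔤, set 𝒵 := φ_1([ξ_2, ξ_3]) and let δ ∈ ℝ be the number with η_1([ξ_2, ξ_3]) = 2δ. Then [𝒵, X] = 2(ψ(ψ(X)) + δ·ψ(X)) for all X ∈ 𝔥. Consequently, 𝒵 lies in the center of 𝔤 if and only if ψ∘ψ + δ·ψ = 0 on 𝔥. -/

import Mathlib

/-- `(i,j,k)` is an even permutation of `(1,2,3)` (indexed here as `(0,1,2)`). -/
def evenPerm (i j k : Fin 3) : Prop :=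
  (i, j, k) = ((0 : Fin 3), (1 : Fin 3), (2 : Fin 3)) ∨
  (i, j, k) = ((1 : Fin 3), (2 : Fin 3), (0 : Fin 3)) ∨
  (i, j, k) = ((2 : Fin 3), (0 : Fin 3), (1 : Fin 3))

/-- An abelian almost 3-contact structure on a real Lie algebra `L`: three almost
contact structures `(φ i, ξ i, η i)` satisfying the quaternionic-like compatibility
relations for every even permutation `(i,j,k)` of `(1,2,3)`, each of which is abelian. -/
structure AbelianAC3 (L : Type*) [LieRing L] [LieAlgebra ℝ L] where
  φ : Fin 3 → (L →ₗ[ℝ] L)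
  ξ : Fin 3 → L
  η : Fin 3 → (L →ₗ[ℝ] ℝ)
  acs : ∀ i, ∀ x : L, φ i (φ i x) = -x + η i x • ξ i
  unit : ∀ i, η i (ξ i) = 1
  comp_phi : ∀ i j k, evenPerm i j k → ∀ x : L, φ k x = φ i (φ j x) - η j x • ξ i
  comp_phi' : ∀ i j k, evenPerm i j k → ∀ x : L, φ k x = -φ j (φ i x) + η i x • ξ j
  comp_xi : ∀ i j k, evenPerm i j k → φ i (ξ j) = ξ k
  comp_xi' : ∀ i j k, evenPerm i j k → φ j (ξ i) = -ξ k
  comp_eta : ∀ i j k, evenPerm i j k → ∀ x : L, η i (φ j x) = η k x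
  comp_eta' : ∀ i j k, evenPerm i j k → ∀ x : L, η j (φ i x) = -η k x
  abelian_ad : ∀ i, ∀ x : L, ⁅ξ i, φ i x⁆ = φ i ⁅ξ i, x⁆
  abelian_br : ∀ i, ∀ X Y : L, η i X = 0 → η i Y = 0 → ⁅φ i X, φ i Y⁆ = ⁅X, Y⁆

namespace AbelianAC3

variable {L : Type*} [LieRing L] [LieAlgebra ℝ L]

/-- Membership in the horizontal subspace `𝔥 = ⋂ ker (η i)`. -/
def inH (S : AbelianAC3 L) (x : L) : Prop := ∀ i, S.η i x = 0

/-- The horizontal subspace `𝔥` as a submodule. -/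
def H (S : AbelianAC3 L) : Submodule ℝ L :=
  LinearMap.ker (S.η 0) ⊓ LinearMap.ker (S.η 1) ⊓ LinearMap.ker (S.η 2)

/-- The vertical subspace `𝔳 = span{ξ₁, ξ₂, ξ₃}`. -/
def V (S : AbelianAC3 L) : Submodule ℝ L :=
  Submodule.span ℝ {S.ξ 0, S.ξ 1, S.ξ 2}

/-- The endomorphism `ψ(X) = [ξ₁, φ₁ X]` (as a linear map on all of `L`). -/
def psi (S : AbelianAC3 L) : L →ₗ[ℝ] L :=
  (LieAlgebra.ad ℝ L (S.ξ 0)) ∘ₗ (S.φ 0)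

/-- The distinguished horizontal vector `𝒵 = φ₁([ξ₂, ξ₃])`. -/
def Z (S : AbelianAC3 L) : L := S.φ 0 ⁅S.ξ 1, S.ξ 2⁆

end AbelianAC3

theorem evenPerm.rotate {i j k : Fin 3} (h : evenPerm i j k) : evenPerm j k i := by
  simp only [evenPerm, Prod.mk.injEq] at h ⊢
  tauto

theorem evenPerm_zero_one_two : evenPerm 0 1 2 := Or.inl rfl

theorem exists_evenPerm (i : Fin 3) : ∃ j k, evenPerm i j k := by
  fin_cases i
  · exact ⟨1, 2, Or.inl rfl⟩
  · exact ⟨2, 0, Or.inr (Or.inl rfl)⟩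
  · exact ⟨0, 1, Or.inr (Or.inr rfl)⟩

namespace AbelianAC3

variable {L : Type*} [LieRing L] [LieAlgebra ℝ L] (S : AbelianAC3 L)

theorem phi_xi_self (i : Fin 3) : S.φ i (S.ξ i) = 0 := by
  have h : S.φ i (S.φ i (S.ξ i)) = 0 := by rw [S.acs, S.unit]; simp
  have h' := S.acs i (S.φ i (S.ξ i))
  rw [h, map_zero] at h'
  have e : S.φ i (S.ξ i) = S.η i (S.φ i (S.ξ i)) • S.ξ i := by
    rw [← sub_eq_zero, ← neg_eq_zero, h']; abel
  set c := S.η i (S.φ i (S.ξ i))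
  rw [e, map_smul, e, smul_smul] at h
  have hc : c * c = 0 := by simpa [S.unit] using congrArg (S.η i) h
  rw [e, mul_self_eq_zero.mp hc, zero_smul]

theorem eta_phi_self (i : Fin 3) (x : L) : S.η i (S.φ i x) = 0 := by
  have h := S.acs i (S.φ i x)
  rw [S.acs i x, map_add, map_neg, map_smul, phi_xi_self, smul_zero, add_zero,
    left_eq_add] at h
  simpa [S.unit] using congrArg (S.η i) h

theorem eta_xi {i j k : Fin 3} (h : evenPerm i j k) : S.η i (S.ξ j) = 0 := by
  rw [← neg_eq_zero, ← S.comp_eta' _ _ _ h.rotate, phi_xi_self, map_zero]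

theorem eta_xi' {i j k : Fin 3} (h : evenPerm i j k) : S.η j (S.ξ i) = 0 := by
  rw [← S.comp_eta _ _ _ h.rotate.rotate, phi_xi_self, map_zero]

theorem eta_lie_xi (i : Fin 3) (x : L) : S.η i ⁅S.ξ i, x⁆ = 0 := by
  have h : ⁅S.ξ i, x⁆ = -S.φ i ⁅S.ξ i, S.φ i x⁆ := by
    rw [← S.abelian_ad, S.acs]; simp
  rw [h, map_neg, eta_phi_self, neg_zero]

variable {S}

theorem inH.of_evenPerm {i j k : Fin 3} (h : evenPerm i j k) {x : L} (hi : S.η i x = 0)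
    (hj : S.η j x = 0) (hk : S.η k x = 0) : S.inH x := by
  intro l
  simp only [evenPerm, Prod.mk.injEq] at h
  rcases h with ⟨rfl, rfl, rfl⟩ | ⟨rfl, rfl, rfl⟩ | ⟨rfl, rfl, rfl⟩ <;>
    fin_cases l <;> assumption

theorem inH.phi {X : L} (hX : S.inH X) (i : Fin 3) : S.inH (S.φ i X) := by
  obtain ⟨j, k, h⟩ := exists_evenPerm i
  refine .of_evenPerm h (S.eta_phi_self i X) ?_ ?_
  · rw [S.comp_eta' _ _ _ h, hX, neg_zero]
  · rw [S.comp_eta _ _ _ h.rotate.rotate, hX]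

theorem lie_xi_phi {X : L} (hX : S.inH X) {i j k : Fin 3} (h : evenPerm i j k) :
    ⁅S.ξ j, S.φ k X⁆ = ⁅S.ξ i, X⁆ := by
  rw [← S.comp_xi _ _ _ h.rotate.rotate]
  exact S.abelian_br k _ _ (S.eta_xi h.rotate.rotate) (hX k)

theorem inH.lie_xi {X : L} (hX : S.inH X) (i : Fin 3) : S.inH ⁅S.ξ i, X⁆ := by
  obtain ⟨j, k, h⟩ := exists_evenPerm i
  refine .of_evenPerm h (S.eta_lie_xi i X) ?_ ?_
  · rw [← lie_xi_phi hX h, eta_lie_xi]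
  · have e := S.abelian_br j (S.ξ i) X (S.eta_xi' h) (hX j)
    rw [← e, S.comp_xi' _ _ _ h, neg_lie, map_neg, eta_lie_xi, neg_zero]

theorem lie_xi_phi_eq_of_evenPerm {X : L} (hX : S.inH X) {i j k : Fin 3}
    (h : evenPerm i j k) : ⁅S.ξ j, S.φ j X⁆ = ⁅S.ξ i, S.φ i X⁆ := by
  rw [← lie_xi_phi (hX.phi i) h, S.comp_phi _ _ _ h.rotate.rotate, hX, zero_smul, sub_zero]

theorem lie_xi_phi_self {X : L} (hX : S.inH X) (i : Fin 3) :
    ⁅S.ξ i, S.φ i X⁆ = S.psi X := by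
  have h := evenPerm_zero_one_two
  have h₁ := lie_xi_phi_eq_of_evenPerm hX h
  have h₂ := lie_xi_phi_eq_of_evenPerm hX h.rotate
  fin_cases i
  · rfl
  · exact h₁
  · exact h₂.trans h₁

theorem inH.psi {X : L} (hX : S.inH X) : S.inH (S.psi X) :=
  (hX.phi 0).lie_xi 0

theorem psi_phi {X : L} (hX : S.inH X) (i : Fin 3) : S.psi (S.φ i X) = S.φ i (S.psi X) := by
  rw [← lie_xi_phi_self (hX.phi i) i, S.abelian_ad, lie_xi_phi_self hX]

theorem phi_phi_self {X : L} (hX : S.inH X) (i : Fin 3) : S.φ i (S.φ i X) = -X := by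
  rw [S.acs, hX, zero_smul, add_zero]

theorem lie_xi_of_inH {X : L} (hX : S.inH X) (i : Fin 3) :
    ⁅S.ξ i, X⁆ = -S.φ i (S.psi X) := by
  rw [← lie_xi_phi_self hX i, S.abelian_ad, phi_phi_self (hX.lie_xi i), neg_neg]

theorem lie_xi_lie_xi {X : L} (hX : S.inH X) (i j : Fin 3) :
    ⁅S.ξ i, ⁅S.ξ j, X⁆⁆ = S.φ i (S.φ j (S.psi (S.psi X))) := by
  rw [lie_xi_of_inH hX j, lie_neg, lie_xi_of_inH (hX.psi.phi j) i, neg_neg, psi_phi hX.psi]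

variable (S)

theorem phi_lie_xi_xi {i j k : Fin 3} (h : evenPerm i j k) :
    S.φ j ⁅S.ξ k, S.ξ i⁆ = S.φ i ⁅S.ξ j, S.ξ k⁆ := by
  have e : ⁅S.ξ k, S.ξ i⁆ = S.φ k ⁅S.ξ j, S.ξ k⁆ := by
    rw [← lie_skew (S.ξ j), map_neg, ← S.abelian_ad, S.comp_xi' _ _ _ h.rotate, lie_neg, neg_neg]
  have e' : S.η k ⁅S.ξ j, S.ξ k⁆ = 0 := by
    rw [← lie_skew, map_neg, eta_lie_xi, neg_zero]
  rw [e, S.comp_phi _ _ _ h.rotate, e', zero_smul, sub_zero]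

theorem inH_Z : S.inH S.Z := by
  have h := evenPerm_zero_one_two
  refine .of_evenPerm h (S.eta_phi_self 0 _) ?_ ?_
  · rw [Z, S.comp_eta' _ _ _ h, ← lie_skew, map_neg, eta_lie_xi, neg_neg]
  · rw [Z, S.comp_eta _ _ _ h.rotate.rotate, eta_lie_xi]

theorem psi_Z : S.psi S.Z = 0 := by
  have key {i j k : Fin 3} (hZ : S.φ i ⁅S.ξ j, S.ξ k⁆ = S.Z) :
      S.psi S.Z = -⁅S.ξ i, ⁅S.ξ j, S.ξ k⁆⁆ := by
    rw [← lie_xi_phi_self S.inH_Z i, S.abelian_ad, ← hZ, S.abelian_ad, S.acs, eta_lie_xi,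
      zero_smul, add_zero]
  have h := evenPerm_zero_one_two
  have h₀ := key (i := 0) rfl
  have h₁ := key (S.phi_lie_xi_xi h)
  have h₂ := key ((S.phi_lie_xi_xi h.rotate).trans (S.phi_lie_xi_xi h))
  have jac := lie_jacobi (S.ξ 0) (S.ξ 1) (S.ξ 2)
  have h₃ : (3 : ℝ) • S.psi S.Z = 0 := by
    calc (3 : ℝ) • S.psi S.Z = S.psi S.Z + S.psi S.Z + S.psi S.Z := by module
      _ = -(⁅S.ξ 0, ⁅S.ξ 1, S.ξ 2⁆⁆ + ⁅S.ξ 1, ⁅S.ξ 2, S.ξ 0⁆⁆ + ⁅S.ξ 2, ⁅S.ξ 0, S.ξ 1⁆⁆) := by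
        nth_rw 1 [h₀]; nth_rw 1 [h₁]; rw [h₂]; abel
      _ = 0 := by rw [jac, neg_zero]
  exact (smul_eq_zero.mp h₃).resolve_left (by norm_num)

theorem lie_Z_xi (i : Fin 3) : ⁅S.Z, S.ξ i⁆ = 0 := by
  rw [← lie_skew, lie_xi_of_inH S.inH_Z, psi_Z, map_zero, neg_zero, neg_zero]

theorem inH_sub_vertical (x : L) :
    S.inH (x - (S.η 0 x • S.ξ 0 + S.η 1 x • S.ξ 1 + S.η 2 x • S.ξ 2)) := by
  have h := evenPerm_zero_one_two
  have h' := h.rotate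
  have h'' := h'.rotate
  refine .of_evenPerm h ?_ ?_ ?_ <;>
    simp [S.unit, S.eta_xi h, S.eta_xi h', S.eta_xi h'', S.eta_xi' h, S.eta_xi' h',
      S.eta_xi' h'']

theorem lie_Z_eq_zero_iff :
    (∀ x : L, ⁅S.Z, x⁆ = 0) ↔ ∀ X : L, S.inH X → ⁅S.Z, X⁆ = 0 := by
  refine ⟨fun h X _ => h X, fun h x => ?_⟩
  simpa [lie_Z_xi] using h _ (S.inH_sub_vertical x)

variable {S} {δ : ℝ}

theorem lie_phi_Z (hδ : S.η 0 ⁅S.ξ 1, S.ξ 2⁆ = 2 * δ) {X : L} (hX : S.inH X) :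
    ⁅S.φ 0 S.Z, X⁆ = -S.φ 0 ((2 : ℝ) • (S.psi (S.psi X) + δ • S.psi X)) := by
  have h := evenPerm_zero_one_two
  have hψ := hX.psi.psi
  have e : ⁅⁅S.ξ 1, S.ξ 2⁆, X⁆ = (2 : ℝ) • S.φ 0 (S.psi (S.psi X)) := by
    have e₁ := S.comp_phi _ _ _ h.rotate (S.psi (S.psi X))
    have e₂ := S.comp_phi' _ _ _ h.rotate (S.psi (S.psi X))
    rw [hψ, zero_smul, sub_zero] at e₁
    rw [hψ, zero_smul, add_zero] at e₂
    rw [lie_lie, lie_xi_lie_xi hX, lie_xi_lie_xi hX, ← e₁, sub_eq_add_neg, ← e₂, two_smul]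
  rw [Z, S.acs, hδ, add_lie, neg_lie, smul_lie, e, lie_xi_of_inH hX]
  simp only [map_smul, map_add]
  module

theorem lie_Z_of_inH (hδ : S.η 0 ⁅S.ξ 1, S.ξ 2⁆ = 2 * δ) {X : L} (hX : S.inH X) :
    ⁅S.Z, X⁆ = (2 : ℝ) • (S.psi (S.psi X) + δ • S.psi X) := by
  have e := S.abelian_br 0 S.Z X (S.inH_Z 0) (hX 0)
  rw [← e, lie_phi_Z hδ (hX.phi 0), psi_phi hX, psi_phi hX.psi, ← map_smul, ← map_add,
    ← map_smul, S.acs]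
  simp [hX.psi 0, hX.psi.psi 0]

end AbelianAC3

/-- `ad_𝒵 = 2(ψ² + δψ)` on `𝔥`, and `𝒵` is central iff `ψ² + δψ = 0`. -/
theorem AbelianAC3.ad_Z
    {L : Type*} [LieRing L] [LieAlgebra ℝ L] [FiniteDimensional ℝ L]
    (S : AbelianAC3 L) (δ : ℝ) (hδ : S.η 0 ⁅S.ξ 1, S.ξ 2⁆ = 2 * δ) :
    (∀ X : L, S.inH X → ⁅S.Z, X⁆ = (2 : ℝ) • (S.psi (S.psi X) + δ • S.psi X)) ∧
    ((∀ x : L, ⁅S.Z, x⁆ = 0) ↔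
      (∀ X : L, S.inH X → S.psi (S.psi X) + δ • S.psi X = 0)) := by
  refine ⟨fun X hX => AbelianAC3.lie_Z_of_inH hδ hX, S.lie_Z_eq_zero_iff.trans ?_⟩
  refine forall₂_congr fun X hX => ?_
  rw [AbelianAC3.lie_Z_of_inH hδ hX, smul_eq_zero_iff_right two_ne_zero]
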